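/- arXiv:1812.04827 — 2 statements merged into one kernel-verified Lean document; each statement's English description precedes it below -/
import Mathlib

section
/- Let X be a continuously distributed random variable on an atomless probability space, let β ∈ (0,1), let Y be a random variable with Y ↑_β X, set B = A^X_{1−β}, and let α ∈ (0,1) with α > β. Then Q_α(Y) = Q_α(z·1_B + Y·1_{B^c}) for every z ≥ Q_α(Y). -/
open MeasureTheory Set

/-- Value-at-Risk at level `p`: `VaR_p(X) = inf {x ∈ ℝ : ℙ(X ≤ x) > p}`. -/
noncomputable def VaR {Ω : Type*} [MeasurableSpace Ω] (μ : Measure Ω) (X : Ω → ℝ) (p : ℝ) : ℝ :=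
  sInf {x : ℝ | p < (μ {ω | X ω ≤ x}).toReal}

/-- The upper-tail event `A^X_p = {ω ∈ Ω : X ω > VaR_p(X)}`. -/
def tailSet {Ω : Type*} [MeasurableSpace Ω] (μ : Measure Ω) (X : Ω → ℝ) (p : ℝ) : Set Ω :=
  {ω | VaR μ X p < X ω}

/-- `X` is continuously distributed under `μ`. -/
def ContinuouslyDistributed {Ω : Type*} [MeasurableSpace Ω] (μ : Measure Ω) (X : Ω → ℝ) : Prop :=
  ∀ x : ℝ, μ {ω | X ω = x} = 0

/-- `μ` is an atomless measure: every non-null measurable set has a measurable subset of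
strictly smaller positive measure. -/
def Atomless {Ω : Type*} [MeasurableSpace Ω] (μ : Measure Ω) : Prop :=
  ∀ s : Set Ω, MeasurableSet s → 0 < μ s →
    ∃ t ⊆ s, MeasurableSet t ∧ 0 < μ t ∧ μ t < μ s

/-- `X` and `Y` are weakly comonotonic with respect to the product measure `π₁ × π₂`:
`∬ (X ω − X ω')(Y ω − Y ω') π₁(dω) π₂(dω') ≥ 0`. -/
def WeaklyComonotonic {Ω : Type*} [MeasurableSpace Ω] (X Y : Ω → ℝ)
    (π₁ π₂ : Measure Ω) : Prop :=
  0 ≤ ∫ q : Ω × Ω, (X q.1 - X q.2) * (Y q.1 - Y q.2) ∂(π₁.prod π₂)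

/-- `X` and `Y` are weakly antimonotonic with respect to the product measure `π₁ × π₂`:
`∬ (X ω − X ω')(Y ω − Y ω') π₁(dω) π₂(dω') ≤ 0`. -/
def WeaklyAntimonotonic {Ω : Type*} [MeasurableSpace Ω] (X Y : Ω → ℝ)
    (π₁ π₂ : Measure Ω) : Prop :=
  ∫ q : Ω × Ω, (X q.1 - X q.2) * (Y q.1 - Y q.2) ∂(π₁.prod π₂) ≤ 0

/-- Left quantile at level `α`: `Q_α(Y) = inf {x ∈ ℝ : ℙ(Y ≤ x) ≥ 1 − α}`. -/
noncomputable def Qleft {Ω : Type*} [MeasurableSpace Ω] (μ : Measure Ω) (Y : Ω → ℝ) (α : ℝ) : ℝ :=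
  sInf {x : ℝ | 1 - α ≤ (μ {ω | Y ω ≤ x}).toReal}

/-- `Y ↑_β Z`: `Y` and `Z` are weakly comonotonic with respect to
`∪_{p ∈ [1−β, 1)} 𝒫^Z_p` (no constraint when `β = 0`). -/
def UpBeta {Ω : Type*} [MeasurableSpace Ω] (μ : Measure Ω) (Y Z : Ω → ℝ) (β : ℝ) : Prop :=
  ∀ p ∈ Set.Ico (1 - β) 1, ∀ ω ∈ tailSet μ Z p, ∀ ω' ∉ tailSet μ Z p,
    WeaklyComonotonic Y Z (Measure.dirac ω) (Measure.dirac ω')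

section

open Filter Topology ProbabilityTheory

variable {Ω : Type*} [MeasurableSpace Ω] {μ : Measure Ω}

lemma toReal_measure_le_eq_cdf_map [IsProbabilityMeasure μ] {X : Ω → ℝ} (hX : Measurable X)
    (x : ℝ) : (μ {ω | X ω ≤ x}).toReal = cdf (μ.map X) x := by
  have := Measure.isProbabilityMeasure_map (μ := μ) hX.aemeasurable
  rw [cdf_eq_real, map_measureReal_apply hX measurableSet_Iic]
  rfl

lemma toReal_measure_mono [IsFiniteMeasure μ] {s t : Set Ω} (h : s ⊆ t) :
    (μ s).toReal ≤ (μ t).toReal :=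
  ENNReal.toReal_mono (measure_ne_top μ t) (measure_mono h)

/-- A lower bound for the distribution function on a nonempty set persists at its infimum. -/
lemma le_toReal_measure_le_sInf [IsProbabilityMeasure μ] {X : Ω → ℝ} (hX : Measurable X)
    {c : ℝ} {S : Set ℝ} (hS : S.Nonempty) (hc : ∀ x ∈ S, c ≤ (μ {ω | X ω ≤ x}).toReal) :
    c ≤ (μ {ω | X ω ≤ sInf S}).toReal := by
  simp only [toReal_measure_le_eq_cdf_map hX] at hc ⊢
  have ht : Tendsto (cdf (μ.map X)) (𝓝[>] sInf S) (𝓝 (cdf (μ.map X) (sInf S))) :=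
    ((cdf (μ.map X)).right_continuous (sInf S)).mono Ioi_subset_Ici_self
  refine ge_of_tendsto ht ?_
  filter_upwards [self_mem_nhdsWithin] with x hx
  obtain ⟨s, hs, hsx⟩ := exists_lt_of_csInf_lt hS hx
  exact (hc s hs).trans (monotone_cdf _ hsx.le)

lemma exists_lt_toReal_measure_le [IsProbabilityMeasure μ] {X : Ω → ℝ} (hX : Measurable X)
    {c : ℝ} (hc : c < 1) : ∃ x : ℝ, c < (μ {ω | X ω ≤ x}).toReal := by
  simp only [toReal_measure_le_eq_cdf_map hX]
  exact ((tendsto_cdf_atTop _).eventually (lt_mem_nhds hc)).exists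

lemma le_toReal_measure_le_VaR [IsProbabilityMeasure μ] {X : Ω → ℝ} (hX : Measurable X)
    {p : ℝ} (hp : p < 1) : p ≤ (μ {ω | X ω ≤ VaR μ X p}).toReal :=
  le_toReal_measure_le_sInf hX (exists_lt_toReal_measure_le hX hp) fun _ hx => le_of_lt hx

lemma le_toReal_measure_le_Qleft [IsProbabilityMeasure μ] {Y : Ω → ℝ} (hY : Measurable Y)
    {α : ℝ} (hα : 0 < α) : 1 - α ≤ (μ {ω | Y ω ≤ Qleft μ Y α}).toReal :=
  le_toReal_measure_le_sInf hY
    ((exists_lt_toReal_measure_le hY (by linarith)).imp fun _ hx => le_of_lt hx) fun _ hx => hx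

lemma weaklyComonotonic_dirac_iff {X Y : Ω → ℝ} (hX : Measurable X) (hY : Measurable Y)
    (ω ω' : Ω) : WeaklyComonotonic X Y (Measure.dirac ω) (Measure.dirac ω') ↔
      0 ≤ (X ω - X ω') * (Y ω - Y ω') := by
  rw [WeaklyComonotonic, Measure.dirac_prod_dirac, integral_dirac']
  exact Measurable.stronglyMeasurable (by fun_prop)

/-- If `Y ↑_β X`, every value of `Y` on the tail event dominates every value off it. -/
lemma UpBeta.le_of_mem_tailSet {X Y : Ω → ℝ} {β : ℝ} (hup : UpBeta μ Y X β)
    (hX : Measurable X) (hY : Measurable Y) (hβ : 0 < β) {ω ω' : Ω}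
    (hω : ω ∈ tailSet μ X (1 - β)) (hω' : ω' ∉ tailSet μ X (1 - β)) : Y ω' ≤ Y ω := by
  have h := (weaklyComonotonic_dirac_iff hY hX ω ω').1
    (hup (1 - β) ⟨le_rfl, by linarith⟩ ω hω ω' hω')
  have hlt : X ω' < X ω := (not_lt.1 hω').trans_lt hω
  exact sub_nonneg.1 (nonneg_of_mul_nonneg_left h (sub_pos.2 hlt))

end

/-- Lemma 6.2(iii) (Wang–Zitikis, "Weak comonotonicity"). If `Y ↑_β X`, `B = A^X_{1−β}`
and `α > β`, then `Q_α(Y) = Q_α(z·1_B + Y·1_{Bᶜ})` for every `z ≥ Q_α(Y)`. -/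
theorem upBeta_quantile_replace_tail_above {Ω : Type*} [MeasurableSpace Ω]
    (μ : Measure Ω) [IsProbabilityMeasure μ] (hμ : Atomless μ)
    (X : Ω → ℝ) (hX : Measurable X) (hXc : ContinuouslyDistributed μ X)
    (β : ℝ) (hβ : β ∈ Set.Ioo (0 : ℝ) 1)
    (Y : Ω → ℝ) (hY : Measurable Y) (hup : UpBeta μ Y X β)
    (α : ℝ) (hα : α ∈ Set.Ioo (0 : ℝ) 1) (hαβ : β < α) :
    ∀ z : ℝ, Qleft μ Y α ≤ z →
      Qleft μ Y α =
        Qleft μ (fun ω => (tailSet μ X (1 - β)).indicator (fun _ => z) ω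
          + ((tailSet μ X (1 - β))ᶜ).indicator Y ω) α := by
  intro z hz
  set B := tailSet μ X (1 - β) with hB
  have hBc : 1 - α ≤ (μ Bᶜ).toReal := by
    have h := le_toReal_measure_le_VaR (μ := μ) hX (p := 1 - β) (by linarith [hβ.1])
    have hset : {ω | X ω ≤ VaR μ X (1 - β)} = Bᶜ := by
      ext ω
      simp [hB, tailSet]
    rw [hset] at h
    linarith
  have hdom : ∀ ω ∈ B, ∀ ω' ∉ B, Y ω' ≤ Y ω := fun ω hω ω' hω' =>
    hup.le_of_mem_tailSet hX hY hβ.1 hω hω'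
  have hq := le_toReal_measure_le_Qleft (μ := μ) hY hα.1
  set W : Ω → ℝ := fun ω => B.indicator (fun _ => z) ω + Bᶜ.indicator Y ω with hW
  have hWB : ∀ ω ∈ B, W ω = z := fun ω hω => by simp [hW, hω]
  have hWBc : ∀ ω ∉ B, W ω = Y ω := fun ω hω => by simp [hW, hω]
  suffices ∀ x : ℝ, 1 - α ≤ (μ {ω | Y ω ≤ x}).toReal ↔ 1 - α ≤ (μ {ω | W ω ≤ x}).toReal from
    congrArg sInf (Set.ext this)
  intro x
  by_cases hx : ∃ ω ∈ B, Y ω ≤ x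
  · obtain ⟨ω, hω, hωx⟩ := hx
    have hYx : ∀ ω' ∉ B, Y ω' ≤ x := fun ω' hω' => (hdom ω hω ω' hω').trans hωx
    exact iff_of_true (hBc.trans (toReal_measure_mono hYx))
      (hBc.trans (toReal_measure_mono fun ω' hω' => (hWBc ω' hω').trans_le (hYx ω' hω')))
  · push Not at hx
    refine ⟨fun h => h.trans (toReal_measure_mono fun ω hω => ?_), fun h => ?_⟩
    · exact (hWBc ω fun hωB => (hx ω hωB).not_ge hω).trans_le hω
    · rcases le_or_gt (Qleft μ Y α) x with hqx | hxq
      · exact hq.trans (toReal_measure_mono fun ω hω => le_trans hω hqx)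
      · refine h.trans (toReal_measure_mono fun ω (hω : W ω ≤ x) => ?_)
        have hωB : ω ∉ B := fun hωB => by
          rw [hWB ω hωB] at hω
          linarith
        exact (hWBc ω hωB).symm.trans_le hω
end

section
/- Let X be a continuously distributed random variable on an atomless probability space, let β ∈ (0,1), set B = A^X_{1−β} (so that ℙ(B) = β), and let α ∈ (0,1) with α + β < 1. Then for every random variable Z and every real number z, Q_α(Z) ≥ Q_{α+β}(z·1_B + Z·1_{B^c}). -/
open MeasureTheory Set

open Filter Topology ProbabilityTheory

lemma bddBelow_le_cdf (ν : Measure ℝ) {c : ℝ} (hc : 0 < c) : BddBelow {x | c ≤ cdf ν x} := by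
  obtain ⟨a, ha⟩ := ((tendsto_cdf_atBot ν).eventually_lt_const hc).exists
  refine ⟨a, fun x hx => ?_⟩
  by_contra! h
  exact absurd (monotone_cdf ν h.le) (not_le.2 (ha.trans_le hx))

lemma nonempty_lt_cdf (ν : Measure ℝ) {c : ℝ} (hc : c < 1) : {x | c < cdf ν x}.Nonempty :=
  ((tendsto_cdf_atTop ν).eventually_const_lt hc).exists

lemma measurableSet_tailSet {Ω : Type*} [MeasurableSpace Ω] (μ : Measure Ω) {X : Ω → ℝ}
    (hX : Measurable X) (p : ℝ) : MeasurableSet (tailSet μ X p) :=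
  measurableSet_lt measurable_const hX

section Quantiles

variable {Ω : Type*} [MeasurableSpace Ω] (μ : Measure Ω) [IsProbabilityMeasure μ]

lemma toReal_measure_le_eq_cdf {Y : Ω → ℝ} (hY : Measurable Y) (x : ℝ) :
    (μ {ω | Y ω ≤ x}).toReal = cdf (μ.map Y) x := by
  have := Measure.isProbabilityMeasure_map (μ := μ) hY.aemeasurable
  rw [cdf_eq_real, Measure.real, Measure.map_apply hY measurableSet_Iic]
  rfl

lemma le_cdf_VaR {X : Ω → ℝ} (hX : Measurable X) {p : ℝ} (hp : p < 1) :
    p ≤ cdf (μ.map X) (VaR μ X p) := by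
  simp only [VaR, toReal_measure_le_eq_cdf μ hX]
  set v := sInf {x | p < cdf (μ.map X) x}
  have hlim : Tendsto (cdf (μ.map X)) (𝓝[>] v) (𝓝 (cdf (μ.map X) v)) :=
    ((cdf (μ.map X)).right_continuous v).mono_left (nhdsWithin_mono _ Ioi_subset_Ici_self)
  refine ge_of_tendsto hlim ?_
  filter_upwards [self_mem_nhdsWithin] with x hx
  obtain ⟨y, hy, hyx⟩ := exists_lt_of_csInf_lt (nonempty_lt_cdf _ hp) hx
  exact (lt_of_lt_of_le hy (monotone_cdf _ hyx.le)).le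

lemma measureReal_tailSet_le {X : Ω → ℝ} (hX : Measurable X) {p : ℝ} (hp : p < 1) :
    μ.real (tailSet μ X p) ≤ 1 - p := by
  have hcompl : (tailSet μ X p)ᶜ = {ω | X ω ≤ VaR μ X p} := by
    ext ω
    simp [tailSet]
  have hle := le_cdf_VaR μ hX hp
  rw [← toReal_measure_le_eq_cdf μ hX, ← hcompl] at hle
  have hadd := probReal_compl_eq_one_sub (μ := μ) (measurableSet_tailSet μ hX p)
  rw [Measure.real] at hadd
  linarith

/-- Changing a random variable on an event of probability at most `β` shifts the level of its
left quantile by at most `β`. -/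
lemma Qleft_add_le_of_eqOn_compl {Y Z : Ω → ℝ} (hY : Measurable Y) (hZ : Measurable Z)
    {B : Set Ω} {α β : ℝ} (hB : μ.real B ≤ β) (hYZ : EqOn Y Z Bᶜ) (hα : 0 < α)
    (hαβ : α + β < 1) : Qleft μ Y (α + β) ≤ Qleft μ Z α := by
  refine csInf_le_csInf ?_ ?_ fun x hx => ?_
  · simp only [toReal_measure_le_eq_cdf μ hY]
    exact bddBelow_le_cdf _ (by linarith)
  · simp only [toReal_measure_le_eq_cdf μ hZ]
    obtain ⟨x, hx⟩ := nonempty_lt_cdf (μ.map Z) (by linarith : 1 - α < 1)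
    exact ⟨x, hx.out.le⟩
  · have hsub : {ω | Z ω ≤ x} ⊆ {ω | Y ω ≤ x} ∪ B := fun ω hω => by
      by_cases h : ω ∈ B
      · exact Or.inr h
      · exact Or.inl ((hYZ h).trans_le hω)
    have hle := (measureReal_mono (μ := μ) hsub).trans (measureReal_union_le _ _)
    simp only [mem_ofPred_eq, Measure.real] at hx hle hB ⊢
    linarith

end Quantiles

/-- Lemma 6.2(v) (Wang–Zitikis, "Weak comonotonicity"). With `B = A^X_{1−β}` (so that
`ℙ(B) = β`) and `α + β < 1`, for every random variable `Z` and real `z`,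
`Q_α(Z) ≥ Q_{α+β}(z·1_B + Z·1_{Bᶜ})`. -/
theorem quantile_tail_replacement_le {Ω : Type*} [MeasurableSpace Ω]
    (μ : Measure Ω) [IsProbabilityMeasure μ] (hμ : Atomless μ)
    (X : Ω → ℝ) (hX : Measurable X) (hXc : ContinuouslyDistributed μ X)
    (β : ℝ) (hβ : β ∈ Set.Ioo (0 : ℝ) 1)
    (α : ℝ) (hα : α ∈ Set.Ioo (0 : ℝ) 1) (hαβ : α + β < 1) :
    ∀ (Z : Ω → ℝ), Measurable Z → ∀ z : ℝ,
      Qleft μ (fun ω => (tailSet μ X (1 - β)).indicator (fun _ => z) ω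
        + ((tailSet μ X (1 - β))ᶜ).indicator Z ω) (α + β) ≤ Qleft μ Z α := by
  intro Z hZ z
  have hB := measurableSet_tailSet μ hX (1 - β)
  refine Qleft_add_le_of_eqOn_compl μ (B := tailSet μ X (1 - β))
    ((measurable_const.indicator hB).add (hZ.indicator hB.compl)) hZ ?_ (fun ω hω => ?_) hα.1 hαβ
  · simpa using measureReal_tailSet_le μ hX (by linarith [hβ.1] : 1 - β < 1)
  · simp [indicator_of_notMem hω, indicator_of_mem hω]
end
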